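/- There exists a function f ∈ W^{2,1}_loc(ℝ) with compactly supported derivative such that for θ ∈ (1/p, 1/2] and p ≥ 2, ∫_{{f ≠ 0}} (|f'|/|f|^θ)^p dx = +∞ while ∫_{{f ≠ 0}} (√|f f''| / |f|^θ)^p dx < ∞. Concretely, f(x) = φ(x) sin(2πx) with φ smooth, φ ≡ 1 on [−1/2,1/2], supported in [−1,1], 0 ≤ φ ≤ 1, has this property. -/

import Mathlib

open MeasureTheory

theorem lintegral_Ioo_rpow_eq_top {s t : ℝ} (ht : 0 < t) (hs : s ≤ -1) :
    ∫⁻ x in Set.Ioo 0 t, ENNReal.ofReal (x ^ s) = ⊤ := by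
  by_contra h
  refine absurd ((intervalIntegral.integrableOn_Ioo_rpow_iff (s := s) ht).1 ?_) hs.not_gt
  have hm : Measurable fun x : ℝ => x ^ s := by fun_prop
  refine ⟨hm.aestronglyMeasurable, ?_⟩
  rw [hasFiniteIntegral_iff_ofReal]
  · exact lt_top_iff_ne_top.2 h
  · filter_upwards [ae_restrict_mem measurableSet_Ioo] with x hx
    exact Real.rpow_nonneg hx.1.le s

/-- If `f` is the identity on `(0, 1)`, then `(|f'| / |f| ^ θ) ^ p` is not integrable on
`{f ≠ 0}` for `θ > 1 / p`. -/
theorem lintegral_deriv_div_rpow_eq_top {f : ℝ → ℝ} (hf : ∀ x ∈ Set.Ioo (0 : ℝ) 1, f x = x)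
    {p θ : ℝ} (hp : 0 < p) (hθ : 1 / p < θ) :
    ∫⁻ x in {x : ℝ | f x ≠ 0}, ENNReal.ofReal ((|deriv f x| / |f x| ^ θ) ^ p) = ⊤ := by
  have hsub : Set.Ioo (0 : ℝ) 1 ⊆ {x : ℝ | f x ≠ 0} := fun x hx => by
    simpa [hf x hx] using hx.1.ne'
  have hs : -(θ * p) ≤ -1 := by
    rw [div_lt_iff₀ hp] at hθ
    linarith
  rw [← top_le_iff, ← lintegral_Ioo_rpow_eq_top one_pos hs]
  refine (setLIntegral_congr_fun measurableSet_Ioo fun x hx => ?_).trans_le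
    (lintegral_mono_set hsub)
  have hd : deriv f x = 1 := by
    have : f =ᶠ[nhds x] id := by
      filter_upwards [isOpen_Ioo.mem_nhds hx] with y hy using hf y hy
    rw [this.deriv_eq, deriv_id]
  simp only [hd, hf x hx, abs_one, abs_of_pos hx.1]
  rw [one_div, ← Real.rpow_neg hx.1.le, ← Real.rpow_mul hx.1.le, neg_mul]

/-- For a compactly supported `C²` function `f` and `θ ≤ 1 / 2`, the function
`(√|f f''| / |f| ^ θ) ^ p` is integrable on `{f ≠ 0}`. -/
theorem lintegral_sqrt_mul_deriv_deriv_div_rpow_lt_top {f : ℝ → ℝ} (hf : ContDiff ℝ 2 f)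
    (hc : HasCompactSupport f) {p θ : ℝ} (hp : 0 ≤ p) (hθ : θ ≤ 1 / 2) :
    ∫⁻ x in {x : ℝ | f x ≠ 0},
      ENNReal.ofReal ((Real.sqrt |f x * deriv (deriv f) x| / |f x| ^ θ) ^ p) < ⊤ := by
  have hf0 : Continuous f := hf.continuous
  have hf2 : Continuous (deriv (deriv f)) := by
    have := hf.continuous_iteratedDeriv 2 le_rfl
    simpa [iteratedDeriv_succ] using this
  set g : ℝ → ℝ := fun x => (√|deriv (deriv f) x| * |f x| ^ (1 / 2 - θ)) ^ p
  have hg : Continuous g :=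
    (hf2.abs.sqrt.mul (hf0.abs.rpow_const fun _ => Or.inr (by linarith))).rpow_const
      fun _ => Or.inr hp
  have hS : MeasurableSet {x : ℝ | f x ≠ 0} := (isOpen_ne_fun hf0 continuous_const).measurableSet
  calc _ = ∫⁻ x in {x : ℝ | f x ≠ 0}, ENNReal.ofReal (g x) := by
        refine setLIntegral_congr_fun hS fun x hx => ?_
        have hpos : 0 < |f x| := abs_pos.2 hx
        simp only [g]
        rw [abs_mul, Real.sqrt_mul hpos.le, Real.rpow_sub hpos, ← Real.sqrt_eq_rpow,
          mul_comm, mul_div_assoc]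
    _ ≤ ∫⁻ x in tsupport f, ENNReal.ofReal (g x) := lintegral_mono_set (subset_tsupport f)
    _ < ⊤ := (hg.continuousOn.integrableOn_compact hc).lintegral_lt_top

theorem counterexample_single_zero :
    ∃ f : ℝ → ℝ, ContDiff ℝ (⊤ : ℕ∞) f ∧ HasCompactSupport (deriv f) ∧
      ∀ p θ : ℝ, 2 ≤ p → 1 / p < θ → θ ≤ 1 / 2 →
        (∫⁻ x in {x : ℝ | f x ≠ 0},
            ENNReal.ofReal ((|deriv f x| / |f x| ^ θ) ^ p) = ⊤) ∧
        (∫⁻ x in {x : ℝ | f x ≠ 0},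
            ENNReal.ofReal
              ((Real.sqrt |f x * deriv (deriv f) x| / |f x| ^ θ) ^ p) < ⊤) := by
  let φ : ContDiffBump (0 : ℝ) := ⟨1, 2, one_pos, one_lt_two⟩
  have hf : ContDiff ℝ (⊤ : ℕ∞) fun x => x * φ x := contDiff_id.mul φ.contDiff
  have hc : HasCompactSupport fun x => x * φ x := φ.hasCompactSupport.mul_left
  refine ⟨fun x => x * φ x, hf, hc.deriv, fun p θ hp hpθ hθ =>
    ⟨lintegral_deriv_div_rpow_eq_top (fun x hx => ?_) (by linarith) hpθ,
      lintegral_sqrt_mul_deriv_deriv_div_rpow_lt_top (contDiff_infty.1 hf 2) hc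
        (by linarith) hθ⟩⟩
  have hx1 : φ x = 1 := φ.one_of_mem_closedBall <| by
    rw [Metric.mem_closedBall, dist_zero_right, Real.norm_eq_abs, abs_of_pos hx.1]
    exact hx.2.le
  rw [hx1, mul_one]
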